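/- Let Γ be a (3,10,41)-graph and let δ denote its minimum degree. Then the vertex connectivity of Γ equals δ; that is, for every set S of fewer than δ vertices the graph obtained from Γ by deleting the vertices of S is connected, and there exists a set of exactly δ vertices whose deletion disconnects Γ. -/

import Mathlib

set_option linter.unusedSectionVars false

def shf : ℕ → ℚ
  | 0 => 1
  | (n+1) => (1 + (((n:ℚ)+1)^2 - ((n:ℚ)+1)) * shf n) / (((n:ℚ)+1)^2 + 1)

theorem shf_convex (d n : ℕ) (hd : d ≤ 8) (hn : n ≤ d) :
    (n:ℚ) * (shf (d-1) - shf d) ≤ shf (d-n) - shf d := by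
  interval_cases d <;> interval_cases n <;> norm_num [shf]

theorem shf_cheb (a b : ℕ) (ha : a ≤ 8) (hb : b ≤ 8) (ha1 : 1 ≤ a) (hb1 : 1 ≤ b) :
    0 ≤ ((a:ℚ) - b) * ((shf (b-1) - shf b) - (shf (a-1) - shf a)) := by
  interval_cases a <;> interval_cases b <;> norm_num [shf]

theorem shf_eq (d : ℕ) (hd : d ≤ 8) :
    1 - shf d - d * shf d - d * (shf (d-1) - shf d) + d * d * (shf (d-1) - shf d) = 0 := by
  interval_cases d <;> norm_num [shf]

theorem shf_anti (a b : ℕ) (hb : b ≤ 8) (h : a ≤ b) : shf b ≤ shf a := by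
  interval_cases b <;> interval_cases a <;> norm_num [shf]

section
variable {V : Type*} [Fintype V] [DecidableEq V] (G : SimpleGraph V) [DecidableRel G.Adj]

def dg (W : Finset V) (v : V) : ℕ := (W.filter (fun w => G.Adj v w)).card

def co (W : Finset V) (p q : V) : ℕ := (W.filter (fun w => G.Adj p w ∧ G.Adj q w)).card

def indep (I : Finset V) : Prop := ∀ x ∈ I, ∀ y ∈ I, ¬ G.Adj x y

def rest (W : Finset V) (p : V) : Finset V := W.filter (fun w => w ≠ p ∧ ¬ G.Adj p w)

theorem dg_mono {W W' : Finset V} (h : W' ⊆ W) (v : V) : dg G W' v ≤ dg G W v :=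
  Finset.card_le_card (Finset.filter_subset_filter _ h)

theorem dg_rest (W : Finset V) (p q : V) (hq : q ∈ rest G W p) :
    dg G (rest G W p) q = dg G W q - co G W p q := by
  have : dg G W q = dg G (rest G W p) q + co G W p q := by
    unfold dg co rest
    rw [← Finset.card_union_of_disjoint]
    · congr 1
      ext w
      simp only [Finset.mem_filter, Finset.mem_union, rest] at hq ⊢
      constructor
      · rintro ⟨h1, h2⟩
        by_cases h : G.Adj p w
        · exact Or.inr ⟨h1, h, h2⟩
        · refine Or.inl ⟨⟨h1, ?_, h⟩, h2⟩
          rintro rfl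
          exact hq.2.2 h2.symm
      · tauto
    · rw [Finset.disjoint_left]
      intro w
      simp only [Finset.mem_filter]
      tauto
  omega

theorem co_le (W : Finset V) (p q : V) : co G W p q ≤ dg G W q := by
  apply Finset.card_le_card
  intro w
  simp only [Finset.mem_filter]
  tauto

theorem co_self (W : Finset V) (p : V) : co G W p p = dg G W p := by
  simp [co, dg]

theorem co_adj (h3 : G.CliqueFree 3) (W : Finset V) (p q : V) (h : G.Adj p q) :
    co G W p q = 0 := by
  unfold co
  rw [Finset.card_eq_zero, Finset.filter_eq_empty_iff]
  rintro w - ⟨h1, h2⟩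
  exact h3 {p, q, w} (SimpleGraph.is3Clique_triple_iff.2 ⟨h, h1, h2⟩)

theorem sum_split (W : Finset V) (p : V) (hp : p ∈ W) (F : V → ℚ) :
    ∑ q ∈ W, F q = F p + ∑ q ∈ W.filter (fun w => G.Adj p w), F q + ∑ q ∈ rest G W p, F q := by
  rw [← Finset.sum_filter_add_sum_filter_not W (fun w => G.Adj p w) F]
  have : p ∈ W.filter (fun w => ¬ G.Adj p w) := by simp [hp]
  rw [← Finset.add_sum_erase _ _ this]
  have : (W.filter (fun w => ¬ G.Adj p w)).erase p = rest G W p := by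
    ext w; simp [rest]; tauto
  rw [this]; ring

theorem sum_co (W : Finset V) (g : V → ℚ) :
    ∑ p ∈ W, ∑ q ∈ W, (co G W p q : ℚ) * g q =
      ∑ q ∈ W, ∑ r ∈ W, if G.Adj q r then (dg G W r : ℚ) * g q else 0 := by
  rw [Finset.sum_comm]
  apply Finset.sum_congr rfl
  intro q _
  have h1 : ∀ p, (co G W p q : ℚ) * g q
      = ∑ r ∈ W, if G.Adj p r ∧ G.Adj q r then g q else 0 := by
    intro p
    rw [← Finset.sum_filter, Finset.sum_const, nsmul_eq_mul]; rfl
  simp_rw [h1]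
  rw [Finset.sum_comm]
  apply Finset.sum_congr rfl
  intro r _
  split_ifs with h
  · simp only [h, and_true]
    rw [← Finset.sum_filter, Finset.sum_const, nsmul_eq_mul]
    simp only [dg, G.adj_comm r]
  · simp [h]

theorem sum_nbr (W : Finset V) (F : V → ℚ) :
    ∑ p ∈ W, ∑ q ∈ W.filter (fun w => G.Adj p w), F q = ∑ q ∈ W, (dg G W q : ℚ) * F q := by
  simp_rw [Finset.sum_filter]
  rw [Finset.sum_comm]
  apply Finset.sum_congr rfl
  intro q _
  rw [← Finset.sum_filter, Finset.sum_const, nsmul_eq_mul]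
  simp only [dg, G.adj_comm q]

theorem sum_cheb (W : Finset V) (hW : ∀ v ∈ W, dg G W v ≤ 8) (g : V → ℚ)
    (hg : ∀ v, g v = shf (dg G W v - 1) - shf (dg G W v)) :
    ∑ q ∈ W, (dg G W q : ℚ) * dg G W q * g q ≤
      ∑ q ∈ W, ∑ r ∈ W, if G.Adj q r then (dg G W r : ℚ) * g q else 0 := by
  have e1 : ∑ q ∈ W, (dg G W q : ℚ) * dg G W q * g q =
      ∑ q ∈ W, ∑ r ∈ W, if G.Adj q r then (dg G W q : ℚ) * g q else 0 := by
    apply Finset.sum_congr rfl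
    intro q _
    rw [← Finset.sum_filter, Finset.sum_const, nsmul_eq_mul, mul_assoc]; rfl
  have sw : ∀ F : V → V → ℚ, (∑ q ∈ W, ∑ r ∈ W, if G.Adj q r then F q r else 0)
      = ∑ q ∈ W, ∑ r ∈ W, if G.Adj q r then F r q else 0 := by
    intro F
    rw [Finset.sum_comm]
    simp only [G.adj_comm]
  rw [e1]
  have s1 := sw (fun q _ => (dg G W q : ℚ) * g q)
  have s2 := sw (fun q r => (dg G W r : ℚ) * g q)
  have : (∑ q ∈ W, ∑ r ∈ W, if G.Adj q r then (dg G W q : ℚ) * g q else 0) +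
     (∑ q ∈ W, ∑ r ∈ W, if G.Adj q r then (dg G W r : ℚ) * g r else 0) ≤
     (∑ q ∈ W, ∑ r ∈ W, if G.Adj q r then (dg G W r : ℚ) * g q else 0) +
     (∑ q ∈ W, ∑ r ∈ W, if G.Adj q r then (dg G W q : ℚ) * g r else 0) := by
    simp only [← Finset.sum_add_distrib]
    apply Finset.sum_le_sum
    intro q hq
    apply Finset.sum_le_sum
    intro r hr
    split_ifs with h
    · have a1 : 1 ≤ dg G W q := Finset.card_pos.2 ⟨r, by simp [hr, h]⟩
      have a2 : 1 ≤ dg G W r := Finset.card_pos.2 ⟨q, by simp [hq, h.symm]⟩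
      have := shf_cheb _ _ (hW q hq) (hW r hr) a1 a2
      rw [← hg, ← hg] at this
      linarith
    · simp
  linarith

theorem exists_good (h3 : G.CliqueFree 3) (W : Finset V) (hW : ∀ v ∈ W, dg G W v ≤ 8)
    (hne : W.Nonempty) :
    ∃ p ∈ W, ∑ q ∈ W, shf (dg G W q) ≤
      1 + ∑ q ∈ rest G W p, shf (dg G (rest G W p) q) := by
  set g : V → ℚ := fun v => shf (dg G W v - 1) - shf (dg G W v) with hg
  set T : V → ℚ := fun p => 1 - shf (dg G W p) -
    ∑ q ∈ W.filter (fun w => G.Adj p w), shf (dg G W q) +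
    (∑ q ∈ W, (co G W p q : ℚ) * g q - dg G W p * g p) with hT
  have key : 0 ≤ ∑ p ∈ W, T p := by
    simp only [hT, Finset.sum_add_distrib, Finset.sum_sub_distrib]
    rw [sum_co, sum_nbr G W (fun q => shf (dg G W q))]
    have h1 := sum_cheb G W hW g (fun _ => rfl)
    have h2 : ∑ q ∈ W, (1 - shf (dg G W q) - dg G W q * shf (dg G W q) - dg G W q * g q
        + dg G W q * dg G W q * g q) = 0 :=
      Finset.sum_eq_zero fun q hq => shf_eq _ (hW q hq)
    simp only [Finset.sum_add_distrib, Finset.sum_sub_distrib] at h2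
    linarith
  obtain ⟨p, hp, hTp⟩ : ∃ p ∈ W, 0 ≤ T p := by
    by_contra! h
    exact absurd key (not_le.2 (Finset.sum_neg h hne))
  refine ⟨p, hp, ?_⟩
  have s1 := sum_split G W p hp (fun q => shf (dg G W q))
  have s2 := sum_split G W p hp (fun q => (co G W p q : ℚ) * g q)
  have s3 : ∑ q ∈ W.filter (fun w => G.Adj p w), (co G W p q : ℚ) * g q = 0 := by
    apply Finset.sum_eq_zero
    intro q hq
    rw [co_adj G h3 W p q (Finset.mem_filter.1 hq).2]; simp
  have s4 : ∑ q ∈ rest G W p, (co G W p q : ℚ) * g q ≤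
      ∑ q ∈ rest G W p, (shf (dg G (rest G W p) q) - shf (dg G W q)) := by
    apply Finset.sum_le_sum
    intro q hq
    rw [dg_rest G W p q hq]
    exact shf_convex _ _ (hW q (Finset.mem_filter.1 hq).1) (co_le G W p q)
  rw [Finset.sum_sub_distrib] at s4
  simp only [co_self] at s2
  simp only [hT] at hTp
  linarith

theorem shearer (h3 : G.CliqueFree 3) (n : ℕ) : ∀ W : Finset V, W.card ≤ n →
    (∀ v ∈ W, dg G W v ≤ 8) →
    ∃ I ⊆ W, indep G I ∧ ∑ q ∈ W, shf (dg G W q) ≤ (I.card : ℚ) := by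
  induction n with
  | zero =>
    intro W hn _
    have : W = ∅ := Finset.card_eq_zero.1 (by omega)
    subst this
    exact ⟨∅, subset_rfl, by simp [indep], by simp⟩
  | succ n ih =>
    intro W hn hW
    rcases W.eq_empty_or_nonempty with rfl | hne
    · exact ⟨∅, subset_rfl, by simp [indep], by simp⟩
    obtain ⟨p, hp, hle⟩ := exists_good G h3 W hW hne
    have hsub : rest G W p ⊆ W := Finset.filter_subset _ _
    have hpn : p ∉ rest G W p := by simp [rest]
    have hlt : (rest G W p).card < W.card :=
      Finset.card_lt_card ⟨hsub, fun h => hpn (h hp)⟩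
    obtain ⟨I, hI, hind, hc⟩ := ih (rest G W p) (by omega)
      (fun v hv => (dg_mono G hsub v).trans (hW v (hsub hv)))
    refine ⟨insert p I, ?_, ?_, ?_⟩
    · exact Finset.insert_subset hp (hI.trans hsub)
    · have hna : ∀ x ∈ I, ¬ G.Adj p x := fun x hx => (Finset.mem_filter.1 (hI hx)).2.2
      intro x hx y hy
      rw [Finset.mem_insert] at hx hy
      rcases hx with rfl | hx <;> rcases hy with rfl | hy
      · exact G.irrefl
      · exact hna y hy
      · exact fun h => hna x hx h.symm
      · exact hind x hx y hy
    · rw [Finset.card_insert_of_notMem (fun h => hpn (hI h))]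
      push_cast
      linarith

theorem nbr_indep (h3 : G.CliqueFree 3) (W : Finset V) (v : V) :
    indep G (W.filter (fun w => G.Adj v w)) := by
  intro x hx y hy h
  exact h3 {v, x, y} (SimpleGraph.is3Clique_triple_iff.2
    ⟨(Finset.mem_filter.1 hx).2, (Finset.mem_filter.1 hy).2, h⟩)

theorem ram (h3 : G.CliqueFree 3) (k : ℕ) (hk : k ≤ 8) (W : Finset V)
    (hW : ∀ I ⊆ W, indep G I → I.card ≤ k) : (W.card : ℚ) * shf k ≤ k := by
  have hd : ∀ v ∈ W, dg G W v ≤ k := fun v _ =>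
    hW _ (Finset.filter_subset _ _) (nbr_indep G h3 W v)
  obtain ⟨I, hI, hind, hc⟩ := shearer G h3 _ W le_rfl (fun v hv => (hd v hv).trans hk)
  have h1 : ∑ q ∈ W, shf k ≤ ∑ q ∈ W, shf (dg G W q) :=
    Finset.sum_le_sum fun q hq => shf_anti _ _ hk (hd q hq)
  rw [Finset.sum_const, nsmul_eq_mul] at h1
  have h2 : (I.card : ℚ) ≤ k := by exact_mod_cast hW I hI hind
  linarith

theorem exists_max (A : Finset V) : ∃ I ⊆ A, indep G I ∧
    ∀ J ⊆ A, indep G J → J.card ≤ I.card := by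
  classical
  obtain ⟨I, hI, hm⟩ := Finset.exists_max_image (A.powerset.filter (fun I => indep G I))
    Finset.card ⟨∅, Finset.mem_filter.2 ⟨by simp, by simp [indep]⟩⟩
  simp only [Finset.mem_filter, Finset.mem_powerset] at hI hm
  exact ⟨I, hI.1, hI.2, fun J h1 h2 => hm J ⟨h1, h2⟩⟩

theorem indep_le (h10 : Gᶜ.CliqueFree 10) (I : Finset V) (hI : indep G I) : I.card ≤ 9 := by
  by_contra! h
  obtain ⟨J, hJ, hc⟩ := Finset.exists_subset_card_eq (show 10 ≤ I.card by omega)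
  refine h10 J ⟨?_, hc⟩
  intro x hx y hy hxy
  exact (SimpleGraph.compl_adj _ _ _).2 ⟨hxy, hI x (hJ hx) y (hJ hy)⟩

theorem sep (h3 : G.CliqueFree 3) (A B S : Finset V)
    (hS : S.card < G.minDegree) (hA : A.Nonempty)
    (hd9 : G.minDegree ≤ 9) (hcard : A.card + B.card + S.card = 41)
    (hnb : ∀ x ∈ A, ∀ y, G.Adj x y → y ∈ A ∪ S) (a b : ℕ) (hab : a + b ≤ 9) (ha4 : a ≤ 4)
    (hAa : ∀ I ⊆ A, indep G I → I.card ≤ a) (hBb : ∀ I ⊆ B, indep G I → I.card ≤ b) :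
    False := by
  obtain ⟨u, hu⟩ := hA
  have ha1 : 1 ≤ a := by
    have := hAa {u} (by simpa using hu) (by simp [indep])
    simpa using this
  have hAS : (A ∪ S).card ≤ A.card + S.card := Finset.card_union_le _ _
  have hud := G.minDegree_le_degree u
  obtain ⟨v, hv, hvS⟩ : ∃ v ∈ G.neighborFinset u, v ∉ S := by
    by_contra! h
    have := Finset.card_le_card (show G.neighborFinset u ⊆ S from h)
    rw [G.card_neighborFinset_eq_degree] at this
    omega
  rw [SimpleGraph.mem_neighborFinset] at hv
  have hvA : v ∈ A := by
    have := hnb u hu v hv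
    rw [Finset.mem_union] at this
    tauto
  have hvd := G.minDegree_le_degree v
  have hdis : Disjoint (G.neighborFinset u) (G.neighborFinset v) := by
    rw [Finset.disjoint_left]
    intro w h1 h2
    rw [SimpleGraph.mem_neighborFinset] at h1 h2
    exact h3 {u, v, w} (SimpleGraph.is3Clique_triple_iff.2 ⟨hv, h1, h2⟩)
  have hle : (G.neighborFinset u ∪ G.neighborFinset v).card ≤ (A ∪ S).card := by
    apply Finset.card_le_card
    intro w hw
    rw [Finset.mem_union, SimpleGraph.mem_neighborFinset, SimpleGraph.mem_neighborFinset] at hw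
    rcases hw with h | h
    · exact hnb u hu w h
    · exact hnb v hvA w h
  rw [Finset.card_union_of_disjoint hdis, G.card_neighborFinset_eq_degree,
    G.card_neighborFinset_eq_degree] at hle
  have r1 := ram G h3 a (by omega) A hAa
  have r2 := ram G h3 (9 - a) (by omega) B
    (fun I h1 h2 => (hBb I h1 h2).trans (by omega))
  interval_cases a
  · have c1 : A.card ≤ 2 := by
      by_contra! h
      have : (3:ℚ) ≤ A.card := by exact_mod_cast h
      norm_num [shf] at r1; linarith
    have c2 : B.card ≤ 38 := by
      by_contra! h
      have : (39:ℚ) ≤ B.card := by exact_mod_cast h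
      norm_num [shf] at r2; linarith
    omega
  · have c1 : A.card ≤ 5 := by
      by_contra! h
      have : (6:ℚ) ≤ A.card := by exact_mod_cast h
      norm_num [shf] at r1; linarith
    have c2 : B.card ≤ 32 := by
      by_contra! h
      have : (33:ℚ) ≤ B.card := by exact_mod_cast h
      norm_num [shf] at r2; linarith
    omega
  · have c1 : A.card ≤ 8 := by
      by_contra! h
      have : (9:ℚ) ≤ A.card := by exact_mod_cast h
      norm_num [shf] at r1; linarith
    have c2 : B.card ≤ 26 := by
      by_contra! h
      have : (27:ℚ) ≤ B.card := by exact_mod_cast h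
      norm_num [shf] at r2; linarith
    omega
  · have c1 : A.card ≤ 13 := by
      by_contra! h
      have : (14:ℚ) ≤ A.card := by exact_mod_cast h
      norm_num [shf] at r1; linarith
    have c2 : B.card ≤ 19 := by
      by_contra! h
      have : (20:ℚ) ≤ B.card := by exact_mod_cast h
      norm_num [shf] at r2; linarith
    omega

end

set_option maxHeartbeats 1000000 in
/-- The vertex connectivity of a (3,10,41)-graph equals its minimum degree δ:
deleting fewer than δ vertices leaves a connected graph, and some set of exactly δ vertices
disconnects the graph. -/
theorem stmt_5 (Γ : SimpleGraph (Fin 41)) [DecidableRel Γ.Adj]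
    (h3 : Γ.CliqueFree 3) (h10 : Γᶜ.CliqueFree 10) :
    (∀ S : Finset (Fin 41), S.card < Γ.minDegree →
      (Γ.induce ((↑S : Set (Fin 41))ᶜ)).Connected) ∧
    (∃ S : Finset (Fin 41), S.card = Γ.minDegree ∧
      ¬ (Γ.induce ((↑S : Set (Fin 41))ᶜ)).Connected) := by
  classical
  have hdeg : ∀ v, Γ.degree v ≤ 9 := by
    intro v
    have := indep_le Γ h10 _ (nbr_indep Γ h3 Finset.univ v)
    rwa [← Γ.card_neighborFinset_eq_degree, Γ.neighborFinset_eq_filter]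
  have hd9 : Γ.minDegree ≤ 9 := (Γ.minDegree_le_degree 0).trans (hdeg 0)
  constructor
  · intro S hS
    by_contra hcon
    have hex : ∃ x, x ∉ S := by
      by_contra! h
      have : S = Finset.univ := Finset.eq_univ_iff_forall.2 h
      rw [this, Finset.card_univ, Fintype.card_fin] at hS
      omega
    obtain ⟨x, hx⟩ := hex
    have hnp : ¬ (Γ.induce ((↑S : Set (Fin 41))ᶜ)).Preconnected := fun h =>
      hcon ((SimpleGraph.connected_iff _).2 ⟨h, ⟨⟨x, by simpa using hx⟩⟩⟩)
    unfold SimpleGraph.Preconnected at hnp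
    push Not at hnp
    obtain ⟨u, v, huv⟩ := hnp
    set H := Γ.induce ((↑S : Set (Fin 41))ᶜ) with hH
    set A : Finset (Fin 41) := Finset.univ.filter
      (fun w => ∃ h : w ∈ ((↑S : Set (Fin 41))ᶜ), H.Reachable u ⟨w, h⟩) with hA
    set B : Finset (Fin 41) := Finset.univ.filter
      (fun w => ∃ h : w ∈ ((↑S : Set (Fin 41))ᶜ), ¬ H.Reachable u ⟨w, h⟩) with hB
    have mA : ∀ w, w ∈ A ↔ ∃ h : w ∈ ((↑S : Set (Fin 41))ᶜ), H.Reachable u ⟨w, h⟩ := by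
      intro w; simp only [hA, Finset.mem_filter, Finset.mem_univ, true_and]
    have mB : ∀ w, w ∈ B ↔ ∃ h : w ∈ ((↑S : Set (Fin 41))ᶜ), ¬ H.Reachable u ⟨w, h⟩ := by
      intro w; simp only [hB, Finset.mem_filter, Finset.mem_univ, true_and]
    have mS : ∀ w, w ∈ ((↑S : Set (Fin 41))ᶜ) ↔ w ∉ S := by intro w; simp
    have hdAB : Disjoint A B := by
      rw [Finset.disjoint_left]
      intro w h1 h2
      obtain ⟨h, h1⟩ := (mA w).1 h1
      obtain ⟨h', h2⟩ := (mB w).1 h2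
      exact h2 h1
    have hdS : Disjoint (A ∪ B) S := by
      rw [Finset.disjoint_left]
      intro w h1
      rw [Finset.mem_union, mA, mB] at h1
      rcases h1 with ⟨h, _⟩ | ⟨h, _⟩ <;> exact (mS w).1 h
    have hall : ∀ w, w ∈ A ∨ w ∈ B ∨ w ∈ S := by
      intro w
      by_cases h : w ∈ S
      · exact Or.inr (Or.inr h)
      · by_cases h' : H.Reachable u ⟨w, (mS w).2 h⟩
        · exact Or.inl ((mA w).2 ⟨_, h'⟩)
        · exact Or.inr (Or.inl ((mB w).2 ⟨_, h'⟩))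
    have hcard : A.card + B.card + S.card = 41 := by
      rw [← Finset.card_union_of_disjoint hdAB, ← Finset.card_union_of_disjoint hdS]
      have : A ∪ B ∪ S = Finset.univ := by
        rw [Finset.eq_univ_iff_forall]
        intro w
        rw [Finset.mem_union, Finset.mem_union, or_assoc]
        exact hall w
      rw [this]; simp
    have hno : ∀ x ∈ A, ∀ y ∈ B, ¬ Γ.Adj x y := by
      intro x hx y hy hxy
      obtain ⟨h1, h2⟩ := (mA x).1 hx
      obtain ⟨h3, h4⟩ := (mB y).1 hy
      apply h4
      refine h2.trans (SimpleGraph.Adj.reachable ?_)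
      simpa [hH] using hxy
    obtain ⟨I, hIA, hI, hIm⟩ := exists_max Γ A
    obtain ⟨J, hJB, hJ, hJm⟩ := exists_max Γ B
    have hIJ : I.card + J.card ≤ 9 := by
      have hd : Disjoint I J := Finset.disjoint_of_subset_left hIA
        (Finset.disjoint_of_subset_right hJB hdAB)
      rw [← Finset.card_union_of_disjoint hd]
      apply indep_le Γ h10
      intro x hx y hy
      rw [Finset.mem_union] at hx hy
      rcases hx with hx | hx <;> rcases hy with hy | hy
      · exact hI x hx y hy
      · exact hno x (hIA hx) y (hJB hy)
      · exact fun h => hno y (hIA hy) x (hJB hx) h.symm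
      · exact hJ x hx y hy
    have hAn : A.Nonempty := ⟨u, (mA _).2 ⟨u.2, SimpleGraph.Reachable.refl _⟩⟩
    have hBn : B.Nonempty := ⟨v, (mB _).2 ⟨v.2, huv⟩⟩
    by_cases h4 : I.card ≤ 4
    · refine sep Γ h3 A B S hS hAn hd9 hcard ?_ _ _ hIJ h4 hIm hJm
      intro x hx y hxy
      rw [Finset.mem_union]
      rcases hall y with h | h | h
      · exact Or.inl h
      · exact absurd hxy (hno x hx y h)
      · exact Or.inr h
    · refine sep Γ h3 B A S hS hBn hd9 (by omega) ?_ J.card I.card (by omega)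
        (by omega) hJm hIm
      intro x hx y hxy
      rw [Finset.mem_union]
      rcases hall y with h | h | h
      · exact absurd hxy.symm (hno y h x hx)
      · exact Or.inl h
      · exact Or.inr h
  · obtain ⟨v, hv⟩ := Γ.exists_minimal_degree_vertex
    refine ⟨Γ.neighborFinset v, by rw [hv, Γ.card_neighborFinset_eq_degree], ?_⟩
    intro hc
    have hvS : v ∈ ((↑(Γ.neighborFinset v) : Set (Fin 41))ᶜ) := by simp
    obtain ⟨w, hw⟩ : ∃ w, w ∉ insert v (Γ.neighborFinset v) := by
      by_contra! h
      have h1 := Finset.eq_univ_iff_forall.2 h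
      have h2 := Finset.card_insert_le v (Γ.neighborFinset v)
      rw [h1, Finset.card_univ, Fintype.card_fin, Γ.card_neighborFinset_eq_degree] at h2
      have := hdeg v
      omega
    rw [Finset.mem_insert, not_or, SimpleGraph.mem_neighborFinset] at hw
    have hwS : w ∈ ((↑(Γ.neighborFinset v) : Set (Fin 41))ᶜ) := by simpa using hw.2
    obtain ⟨p⟩ := hc.preconnected ⟨v, hvS⟩ ⟨w, hwS⟩
    cases p with
    | nil => exact hw.1 rfl
    | cons h q =>
      rename_i z
      have hz := z.2
      have h' : Γ.Adj v z := by simpa using h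
      simp at hz
      exact hz h'
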